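/- Weighted Sobolev inequality under mass and pressure bounds: Let d ≥ 3, γ > d/2, and m, M > 0. There exists a constant C = C(d, γ, m, M) such that for every nonnegative ρ ∈ L^γ(𝕋^d) with ∫ ρ dx ≥ m and ∫ ρ^γ dx ≤ M, and every v ∈ H¹(𝕋^d), one has ‖v‖_{L^{2d/(d−2)}} ≤ C ( ‖√ρ v‖_{L²} + ‖∇v‖_{L²} ). -/

import Mathlib

open MeasureTheory RealInnerProductSpace

noncomputable section

abbrev E (d : ℕ) := EuclideanSpace ℝ (Fin d)

/-- Fundamental domain of the torus `𝕋^d = ℝ^d / ℤ^d` (normalized volume 1). -/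
def Q (d : ℕ) : Set (E d) := {x | ∀ i, x i ∈ Set.Ico (0 : ℝ) 1}

/-- `ℤ^d`-periodicity: a function on `ℝ^d` descending to the torus. -/
def Per {d : ℕ} {V : Type*} (f : E d → V) : Prop :=
  ∀ (x : E d) (k : Fin d → ℤ),
    f (x + (WithLp.equiv 2 (Fin d → ℝ)).symm fun i => (k i : ℝ)) = f x

def e (d : ℕ) (i : Fin d) : E d := EuclideanSpace.single i (1 : ℝ)

/-- Divergence of a vector field. -/
def vdiv {d : ℕ} (u : E d → E d) (x : E d) : ℝ :=
  ∑ i, fderiv ℝ u x (e d i) i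

/-- Componentwise Laplacian of a vector field. -/
def vlap {d : ℕ} (u : E d → E d) (x : E d) : E d :=
  ∑ i, fderiv ℝ (fun y => fderiv ℝ u y (e d i)) x (e d i)

/-- Squared Frobenius norm of the gradient of a vector field. -/
def gradsq {d : ℕ} (u : E d → E d) (x : E d) : ℝ :=
  ∑ i, ‖fderiv ℝ u x (e d i)‖ ^ 2

/-- The standard basis of `ℝ^d`, as a plain basis. -/
def stdBasis (d : ℕ) : Module.Basis (Fin d) ℝ (E d) := (EuclideanSpace.basisFun (Fin d) ℝ).toBasis

lemma Q_eq_fundamentalDomain (d : ℕ) : Q d = ZSpan.fundamentalDomain (stdBasis d) := by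
  ext x
  simp [Q, ZSpan.mem_fundamentalDomain, stdBasis]

lemma measurableSet_Q (d : ℕ) : MeasurableSet (Q d) := by
  rw [Q_eq_fundamentalDomain]
  exact ZSpan.fundamentalDomain_measurableSet _

lemma volume_Q (d : ℕ) : volume (Q d) = 1 := by
  have h := (PiLp.volume_preserving_ofLp (Fin d)).measure_preimage
    (s := Set.univ.pi fun _ => Set.Ico (0 : ℝ) 1)
    (MeasurableSet.univ_pi fun _ => measurableSet_Ico).nullMeasurableSet
  rw [Real.volume_pi_Ico] at h
  have h2 : Q d = (@WithLp.ofLp 2 (Fin d → ℝ)) ⁻¹' (Set.univ.pi fun _ => Set.Ico (0 : ℝ) 1) := by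
    ext x
    simp [Q]
  rw [h2, h]
  simp

instance isProbabilityMeasure_restrict_Q (d : ℕ) :
    IsProbabilityMeasure ((volume : Measure (E d)).restrict (Q d)) :=
  ⟨by rw [Measure.restrict_apply_univ, volume_Q]⟩

lemma Per.add_span {d : ℕ} {V : Type*} {f : E d → V} (hf : Per f) {g : E d}
    (hg : g ∈ Submodule.span ℤ (Set.range (stdBasis d))) (x : E d) : f (x + g) = f x := by
  rw [(stdBasis d).mem_span_iff_repr_mem ℤ] at hg
  choose k hk using hg
  rw [← hf x k]
  congr 2
  ext i
  simpa [stdBasis] using (hk i).symm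

open scoped Pointwise in
lemma setLIntegral_preimage_add_Q {d : ℕ} {f : E d → ENNReal} (hf : Per f) (h : E d) :
    ∫⁻ x in (fun x => x + h) ⁻¹' Q d, f x = ∫⁻ x in Q d, f x := by
  have hQ := ZSpan.isAddFundamentalDomain' (stdBasis d) (volume : Measure (E d))
  rw [← Q_eq_fundamentalDomain] at hQ
  have : Countable (Submodule.span ℤ (Set.range (stdBasis d))).toAddSubgroup :=
    inferInstanceAs (Countable (Submodule.span ℤ (Set.range (stdBasis d))))
  have hT := hQ.vadd_of_comm (-h)
  have hs : (fun x => x + h) ⁻¹' Q d = -h +ᵥ Q d := by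
    ext x
    rw [Set.mem_vadd_set_iff_neg_vadd_mem]
    simp [add_comm]
  rw [hs]
  refine hT.setLIntegral_eq hQ f fun g x => ?_
  rw [AddSubgroup.vadd_def, vadd_eq_add, add_comm]
  exact hf.add_span g.2 x

lemma setLIntegral_Q_add {d : ℕ} {f : E d → ENNReal} (hf : Per f) (h : E d) :
    ∫⁻ x in Q d, f (x + h) = ∫⁻ x in Q d, f x := by
  have := (measurePreserving_add_right (volume : Measure (E d)) h).setLIntegral_comp_preimage_emb
    (measurableEmbedding_addRight h) f ((fun x => x + -h) ⁻¹' Q d)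
  rw [setLIntegral_preimage_add_Q hf] at this
  simpa [← Set.preimage_comp, Function.comp_def] using this

lemma exists_setLIntegral_le_of_isCompact {d : ℕ} {K : Set (E d)} (hK : IsCompact K) :
    ∃ n : ℕ, ∀ f : E d → ENNReal, Per f → ∫⁻ x in K, f x ≤ n * ∫⁻ x in Q d, f x := by
  obtain ⟨t, -, ht, hKt⟩ := hK.finite_cover_balls (e := 1 / 2) (by norm_num)
  lift t to Finset (E d) using ht
  let c : E d := WithLp.toLp 2 fun _ => 1 / 2
  have hsub : K ⊆ ⋃ y ∈ t, (fun x => x + (c - y)) ⁻¹' Q d := by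
    refine hKt.trans (Set.iUnion₂_mono fun y _ x hx i => ?_)
    have h1 : |x i - y i| < 1 / 2 := by
      refine lt_of_le_of_lt ?_ (mem_ball_iff_norm.1 hx)
      simpa using PiLp.norm_apply_le (x - y) i
    rw [abs_lt] at h1
    simp only [PiLp.add_apply, PiLp.sub_apply, c, Set.mem_Ico]
    constructor <;> linarith
  refine ⟨t.card, fun f hf => ?_⟩
  calc ∫⁻ x in K, f x ≤ ∫⁻ x in ⋃ y ∈ t, (fun x => x + (c - y)) ⁻¹' Q d, f x :=
        lintegral_mono_set hsub
    _ ≤ ∑ y ∈ t, ∫⁻ x in (fun x => x + (c - y)) ⁻¹' Q d, f x := by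
        rw [← Finset.set_biUnion_coe, Set.biUnion_eq_iUnion]
        refine (lintegral_iUnion_le _ f).trans ?_
        rw [tsum_fintype]
        exact (t.sum_coe_sort fun y => ∫⁻ x in (fun x => x + (c - y)) ⁻¹' Q d, f x).le
    _ = t.card * ∫⁻ x in Q d, f x := by
        simp [setLIntegral_preimage_add_Q hf]

lemma lintegral_enorm_sq {α F : Type*} [MeasurableSpace α] [NormedAddCommGroup F] (μ : Measure α)
    (f : α → F) : ∫⁻ x, ‖f x‖ₑ ^ 2 ∂μ = eLpNorm f 2 μ ^ 2 := by
  have h := eLpNorm_nnreal_pow_eq_lintegral (f := f) (p := 2) (μ := μ) (by norm_num)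
  simpa using h.symm

lemma Per.fderiv {d : ℕ} {v : E d → ℝ} (hv : Per v) : Per (fderiv ℝ v) := by
  intro x k
  rw [← fderiv_comp_add_right]
  congr 1
  exact funext fun y => hv y k

lemma enorm_add_sub_sq_le {d : ℕ} {v : E d → ℝ} (hv : ContDiff ℝ 1 v) (x h : E d) :
    ‖v (x + h) - v x‖ₑ ^ 2
      ≤ ‖h‖ₑ ^ 2 * ∫⁻ t in Set.Ioc (0 : ℝ) 1, ‖fderiv ℝ v (x + t • h)‖ₑ ^ 2 := by
  have hc : Continuous (fderiv ℝ v) := hv.continuous_fderiv (by norm_num)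
  have hcl : Continuous fun t : ℝ => fderiv ℝ v (x + t • h) := by fun_prop
  have hprob : IsProbabilityMeasure ((volume : Measure ℝ).restrict (Set.Ioc 0 1)) :=
    ⟨by simp⟩
  have hft : ∫ t in (0 : ℝ)..1, fderiv ℝ v (x + t • h) h = v (x + h) - v x := by
    have := intervalIntegral.integral_eq_sub_of_hasDerivAt (a := 0) (b := 1)
      (f := fun t : ℝ => v (x + t • h)) (f' := fun t => fderiv ℝ v (x + t • h) h) (fun t _ => ?_)
      (Continuous.intervalIntegrable (by fun_prop) _ _)
    · simpa using this
    · have h1 : HasDerivAt (fun t : ℝ => x + t • h) h t := by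
        simpa using ((hasDerivAt_id t).smul_const h).const_add x
      exact ((hv.differentiable (by norm_num) (x + t • h)).hasFDerivAt).comp_hasDerivAt t h1
  rw [← hft, intervalIntegral.integral_of_le zero_le_one, lintegral_enorm_sq, ← mul_pow]
  refine pow_le_pow_left' ?_ 2
  calc ‖∫ t in Set.Ioc (0 : ℝ) 1, fderiv ℝ v (x + t • h) h‖ₑ
      ≤ ∫⁻ t in Set.Ioc (0 : ℝ) 1, ‖fderiv ℝ v (x + t • h) h‖ₑ := enorm_integral_le_lintegral_enorm _
    _ ≤ ∫⁻ t in Set.Ioc (0 : ℝ) 1, ‖h‖ₑ * ‖fderiv ℝ v (x + t • h)‖ₑ := by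
        refine lintegral_mono fun t => ?_
        rw [mul_comm]
        exact ContinuousLinearMap.le_opENorm _ _
    _ = ‖h‖ₑ * eLpNorm (fun t : ℝ => fderiv ℝ v (x + t • h)) 1
          (volume.restrict (Set.Ioc 0 1)) := by
        rw [lintegral_const_mul _ hcl.enorm.measurable, eLpNorm_one_eq_lintegral_enorm]
    _ ≤ _ := by
        gcongr
        exact eLpNorm_le_eLpNorm_of_exponent_le (by norm_num) hcl.aestronglyMeasurable

lemma lintegral_add_sub_sq_le {d : ℕ} {v : E d → ℝ} (hv : ContDiff ℝ 1 v) (hper : Per v) (h : E d) :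
    ∫⁻ x in Q d, ‖v (x + h) - v x‖ₑ ^ 2 ≤ ‖h‖ₑ ^ 2 * ∫⁻ x in Q d, ‖fderiv ℝ v x‖ₑ ^ 2 := by
  have hc : Continuous (fderiv ℝ v) := hv.continuous_fderiv (by norm_num)
  calc ∫⁻ x in Q d, ‖v (x + h) - v x‖ₑ ^ 2
      ≤ ∫⁻ x in Q d, ‖h‖ₑ ^ 2 * ∫⁻ t in Set.Ioc (0 : ℝ) 1, ‖fderiv ℝ v (x + t • h)‖ₑ ^ 2 :=
        lintegral_mono fun x => enorm_add_sub_sq_le hv x h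
    _ = ‖h‖ₑ ^ 2 * ∫⁻ x in Q d, ∫⁻ t in Set.Ioc (0 : ℝ) 1, ‖fderiv ℝ v (x + t • h)‖ₑ ^ 2 :=
        lintegral_const_mul' _ _ (by finiteness)
    _ = ‖h‖ₑ ^ 2 * ∫⁻ t in Set.Ioc (0 : ℝ) 1, ∫⁻ x in Q d, ‖fderiv ℝ v (x + t • h)‖ₑ ^ 2 := by
        rw [lintegral_lintegral_swap]
        have : Continuous fun p : E d × ℝ => fderiv ℝ v (p.1 + p.2 • h) := by fun_prop
        exact (this.enorm.measurable.pow_const 2).aemeasurable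
    _ = ‖h‖ₑ ^ 2 * ∫⁻ x in Q d, ‖fderiv ℝ v x‖ₑ ^ 2 := by
        have hp : Per fun x => ‖fderiv ℝ v x‖ₑ ^ 2 := fun x k => by
          simp only [hper.fderiv x k]
        simp [fun t : ℝ => setLIntegral_Q_add hp (t • h)]

lemma norm_le_of_mem_Q {d : ℕ} {x : E d} (hx : x ∈ Q d) : ‖x‖ ≤ √d := by
  rw [EuclideanSpace.norm_eq]
  refine Real.sqrt_le_sqrt ?_
  calc ∑ i, ‖x i‖ ^ 2 ≤ ∑ _i : Fin d, (1 : ℝ) := by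
        refine Finset.sum_le_sum fun i _ => ?_
        have := hx i
        rw [Real.norm_eq_abs, sq_abs]
        nlinarith [this.1, this.2]
    _ = d := by simp

/-- Poincaré inequality on the torus. -/
lemma exists_eLpNorm_sub_const_le {d : ℕ} {v : E d → ℝ} (hv : ContDiff ℝ 1 v) (hper : Per v) :
    ∃ c : ℝ, eLpNorm (fun x => v x - c) 2 (volume.restrict (Q d))
      ≤ ENNReal.ofReal (√d) * eLpNorm (fderiv ℝ v) 2 (volume.restrict (Q d)) := by
  have hvc := hv.continuous
  have hm : Measurable fun y => ∫⁻ x in Q d, ‖v x - v y‖ₑ ^ 2 := by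
    refine Measurable.lintegral_prod_right' (f := fun p : E d × E d => ‖v p.2 - v p.1‖ₑ ^ 2) ?_
    have : Continuous fun p : E d × E d => v p.2 - v p.1 := by fun_prop
    exact this.enorm.measurable.pow_const 2
  obtain ⟨y, hy⟩ := exists_le_lintegral (μ := volume.restrict (Q d)) hm.aemeasurable
  refine ⟨v y, (ENNReal.pow_right_strictMono two_ne_zero).le_iff_le.1 ?_⟩
  rw [mul_pow, ← lintegral_enorm_sq, ← lintegral_enorm_sq]
  refine hy.trans ?_
  calc ∫⁻ y in Q d, ∫⁻ x in Q d, ‖v x - v y‖ₑ ^ 2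
      = ∫⁻ y in Q d, ∫⁻ h in Q d, ‖v (y + h) - v y‖ₑ ^ 2 := by
        refine lintegral_congr fun y => ?_
        have hp : Per fun x => ‖v x - v y‖ₑ ^ 2 := fun x k => by simp only [hper x k]
        simpa only [add_comm] using (setLIntegral_Q_add hp y).symm
    _ = ∫⁻ h in Q d, ∫⁻ y in Q d, ‖v (y + h) - v y‖ₑ ^ 2 := by
        refine lintegral_lintegral_swap ?_
        have : Continuous fun p : E d × E d => v (p.1 + p.2) - v p.1 := by fun_prop
        exact (this.enorm.measurable.pow_const 2).aemeasurable
    _ ≤ ∫⁻ _h in Q d, ENNReal.ofReal (√d) ^ 2 * ∫⁻ x in Q d, ‖fderiv ℝ v x‖ₑ ^ 2 := by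
        refine setLIntegral_mono' (measurableSet_Q d) fun h hh => ?_
        refine (lintegral_add_sub_sq_le hv hper h).trans ?_
        gcongr
        rw [← ofReal_norm]
        exact ENNReal.ofReal_le_ofReal (norm_le_of_mem_Q hh)
    _ = _ := by simp

lemma eLpNorm_two_add_le {α F : Type*} [MeasurableSpace α] [NormedAddCommGroup F] {μ : Measure α} {f g : α → F}
    (hf : AEStronglyMeasurable f μ) (hg : AEStronglyMeasurable g μ) :
    eLpNorm (f + g) 2 μ ≤ eLpNorm f 2 μ + eLpNorm g 2 μ :=
  eLpNorm_add_le hf hg (by norm_num)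

lemma exists_eLpNorm_two_restrict_le_of_isCompact {d : ℕ} {K : Set (E d)} (hK : IsCompact K) :
    ∃ n : ℕ, ∀ (F : Type) [NormedAddCommGroup F] (f : E d → F), Per f →
      eLpNorm f 2 (volume.restrict K) ≤ n * eLpNorm f 2 (volume.restrict (Q d)) := by
  obtain ⟨n, hn⟩ := exists_setLIntegral_le_of_isCompact hK
  refine ⟨n, fun F _ f hf => (ENNReal.pow_right_strictMono two_ne_zero).le_iff_le.1 ?_⟩
  rw [mul_pow, ← lintegral_enorm_sq, ← lintegral_enorm_sq]
  refine (hn _ fun x k => by simp only [hf x k]).trans ?_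
  gcongr
  exact_mod_cast Nat.le_self_pow two_ne_zero n

lemma exists_contDiff_cutoff (d : ℕ) : ∃ χ : E d → ℝ, ContDiff ℝ 1 χ ∧ HasCompactSupport χ ∧
    (∀ x, 0 ≤ χ x ∧ χ x ≤ 1) ∧ ∀ x ∈ Q d, χ x = 1 := by
  let χ : ContDiffBump (0 : E d) := ⟨√d + 1, √d + 2, by positivity, by linarith⟩
  refine ⟨χ, χ.contDiff, χ.hasCompactSupport, fun x => ⟨χ.nonneg, χ.le_one⟩, fun x hx => ?_⟩
  refine χ.one_of_mem_closedBall ?_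
  rw [mem_closedBall_zero_iff]
  exact (norm_le_of_mem_Q hx).trans (by simp [χ])

/-- Sobolev inequality on the torus, with the full `H¹` norm on the right. -/
lemma exists_eLpNorm_le_of_per {d : ℕ} (hd : 0 < d) {p : NNReal}
    (hp : (p : ℝ)⁻¹ = 2⁻¹ - (d : ℝ)⁻¹) :
    ∃ A : NNReal, ∀ v : E d → ℝ, ContDiff ℝ 1 v → Per v →
      eLpNorm v p (volume.restrict (Q d)) ≤ A * (eLpNorm v 2 (volume.restrict (Q d))
        + eLpNorm (fderiv ℝ v) 2 (volume.restrict (Q d))) := by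
  obtain ⟨χ, hχ, hχs, hχ01, hχ1⟩ := exists_contDiff_cutoff d
  obtain ⟨B, hB⟩ := (hχ.continuous_fderiv (by norm_num)).bounded_above_of_compact_support
    (hχs.fderiv (𝕜 := ℝ))
  have hK : IsCompact (tsupport χ) := hχs
  obtain ⟨n, hn⟩ := exists_eLpNorm_two_restrict_le_of_isCompact hK
  let S := eLpNormLESNormFDerivOfEqInnerConst (volume : Measure (E d)) 2
  refine ⟨S * (max 1 B.toNNReal * n), fun v hv hper => ?_⟩
  have hvc := hv.continuous
  have hvd : Continuous (fderiv ℝ v) := hv.continuous_fderiv (by norm_num)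
  have hχd : Continuous (fderiv ℝ χ) := hχ.continuous_fderiv (by norm_num)
  let u : E d → ℝ := fun x => χ x * v x
  have hu : ContDiff ℝ 1 u := hχ.mul hv
  have hfu : fderiv ℝ u = (fun x => χ x • fderiv ℝ v x) + fun x => v x • fderiv ℝ χ x := by
    ext1 x
    exact fderiv_fun_mul (hχ.differentiable (by norm_num) x) (hv.differentiable (by norm_num) x)
  have hsupp : Function.support (fderiv ℝ u) ⊆ tsupport χ :=
    (support_fderiv_subset ℝ).trans (closure_mono (Function.support_mul_subset_left _ _))
  have gns : eLpNorm u p volume ≤ S * eLpNorm (fderiv ℝ u) 2 volume := by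
    have := eLpNorm_le_eLpNorm_fderiv_of_eq_inner volume hu (hχs.mul_right)
      (p := 2) (p' := p) (by norm_num) (by simpa using hd) (by simpa using hp)
    simpa using this
  calc eLpNorm v p (volume.restrict (Q d))
      = eLpNorm u p (volume.restrict (Q d)) := by
        refine eLpNorm_congr_ae ((ae_restrict_iff' (measurableSet_Q d)).2 (.of_forall fun x hx => ?_))
        simp [u, hχ1 x hx]
    _ ≤ eLpNorm u p volume := eLpNorm_restrict_le _ _ _ _
    _ ≤ S * eLpNorm (fderiv ℝ u) 2 volume := gns
    _ = S * eLpNorm (fderiv ℝ u) 2 (volume.restrict (tsupport χ)) := by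
        congr 1
        exact (eLpNorm_restrict_eq_of_support_subset (ε := E d →L[ℝ] ℝ) hsupp).symm
    _ ≤ S * (eLpNorm (fun x => χ x • fderiv ℝ v x) 2 (volume.restrict (tsupport χ))
          + eLpNorm (fun x => v x • fderiv ℝ χ x) 2 (volume.restrict (tsupport χ))) := by
        rw [hfu]
        gcongr
        exact eLpNorm_two_add_le (hχ.continuous.smul hvd).aestronglyMeasurable
          (hvc.smul hχd).aestronglyMeasurable
    _ ≤ S * (eLpNorm (fderiv ℝ v) 2 (volume.restrict (tsupport χ))
          + ENNReal.ofReal B * eLpNorm v 2 (volume.restrict (tsupport χ))) := by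
        gcongr
        · refine eLpNorm_mono fun x => ?_
          rw [norm_smul, Real.norm_of_nonneg (hχ01 x).1]
          exact mul_le_of_le_one_left (norm_nonneg _) (hχ01 x).2
        · refine eLpNorm_le_mul_eLpNorm_of_ae_le_mul (.of_forall fun x => ?_) 2
          rw [norm_smul, mul_comm]
          gcongr
          exact hB x
    _ ≤ S * (1 * (n * eLpNorm (fderiv ℝ v) 2 (volume.restrict (Q d)))
          + ENNReal.ofReal B * (n * eLpNorm v 2 (volume.restrict (Q d)))) := by
        rw [one_mul]
        gcongr
        · exact hn _ _ hper.fderiv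
        · exact hn _ _ hper
    _ ≤ S * (max 1 B.toNNReal * (n * eLpNorm (fderiv ℝ v) 2 (volume.restrict (Q d)))
          + max 1 B.toNNReal * (n * eLpNorm v 2 (volume.restrict (Q d)))) := by
        gcongr
        · exact_mod_cast le_max_left _ _
        · exact le_max_right 1 (B.toNNReal : ENNReal)
    _ = _ := by
        push_cast
        ring

/-- Sobolev–Poincaré inequality on the torus. -/
lemma exists_const_eLpNorm_sub_le {d : ℕ} (hd : 0 < d) {p : NNReal}
    (hp : (p : ℝ)⁻¹ = 2⁻¹ - (d : ℝ)⁻¹) :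
    ∃ A : NNReal, ∀ v : E d → ℝ, ContDiff ℝ 1 v → Per v → ∃ c : ℝ,
      eLpNorm (fun x => v x - c) p (volume.restrict (Q d))
        ≤ A * eLpNorm (fderiv ℝ v) 2 (volume.restrict (Q d)) := by
  obtain ⟨A, hA⟩ := exists_eLpNorm_le_of_per hd hp
  refine ⟨A * ((√d).toNNReal + 1), fun v hv hper => ?_⟩
  obtain ⟨c, hc⟩ := exists_eLpNorm_sub_const_le hv hper
  have hf : fderiv ℝ (fun x => v x - c) = fderiv ℝ v := funext fun x => fderiv_sub_const c
  have h := hA (fun x => v x - c) (hv.sub contDiff_const) fun x k => by simp only [hper x k]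
  rw [hf] at h
  refine ⟨c, h.trans ?_⟩
  push_cast
  rw [mul_assoc, add_mul, one_mul]
  gcongr
  exact hc

/-- The mean-value part of `v` is controlled by the weight. -/
lemma enorm_mul_eLpNorm_sqrt_le {α : Type*} [MeasurableSpace α] {μ : Measure α}
    [IsProbabilityMeasure μ] {ρ v : α → ℝ} (hρ : Measurable ρ) (hv : AEStronglyMeasurable v μ)
    {p q r : ENNReal} (hqr : q ≤ r) [ENNReal.HolderTriple p q 2] (c : ℝ) :
    ‖c‖ₑ * eLpNorm (fun x => √(ρ x)) 2 μ ≤ eLpNorm (fun x => √(ρ x) * v x) 2 μ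
      + eLpNorm (fun x => √(ρ x)) p μ * eLpNorm (fun x => v x - c) r μ := by
  have hs : AEStronglyMeasurable (fun x => √(ρ x)) μ := hρ.sqrt.aestronglyMeasurable
  have hw : AEStronglyMeasurable (fun x => v x - c) μ := hv.sub aestronglyMeasurable_const
  calc ‖c‖ₑ * eLpNorm (fun x => √(ρ x)) 2 μ
      = eLpNorm (c • fun x => √(ρ x)) 2 μ := (eLpNorm_const_smul _ _ _ _).symm
    _ = eLpNorm ((fun x => √(ρ x) * v x) - fun x => √(ρ x) * (v x - c)) 2 μ := by
        congr 1
        ext x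
        simp
        ring
    _ ≤ eLpNorm (fun x => √(ρ x) * v x) 2 μ + eLpNorm (fun x => √(ρ x) * (v x - c)) 2 μ :=
        eLpNorm_sub_le (hs.mul hv) (hs.mul hw) (by norm_num)
    _ ≤ _ := by
        gcongr
        refine (eLpNorm_smul_le_mul_eLpNorm (p := p) (q := q) hw hs).trans ?_
        gcongr
        exact eLpNorm_le_eLpNorm_of_exponent_le hqr hw

lemma eLpNorm_ofReal_eq {α F : Type*} [MeasurableSpace α] [NormedAddCommGroup F] {μ : Measure α}
    {f : α → F} {g : α → ℝ} {p : ℝ} (hp : 0 < p) (hg : Integrable g μ)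
    (h : ∀ x, ‖f x‖ ^ p = g x) :
    eLpNorm f (ENNReal.ofReal p) μ = ENNReal.ofReal ((∫ x, g x ∂μ) ^ (1 / p)) := by
  have hg0 : ∀ x, 0 ≤ g x := fun x => by rw [← h x]; positivity
  rw [eLpNorm_eq_lintegral_rpow_enorm_toReal (by simpa using hp) ENNReal.ofReal_ne_top,
    ENNReal.toReal_ofReal hp.le,
    ← ENNReal.ofReal_rpow_of_nonneg (integral_nonneg hg0) (by positivity),
    ofReal_integral_eq_lintegral_ofReal hg (.of_forall hg0)]
  congr 2
  ext x
  rw [← h x, ← ENNReal.ofReal_rpow_of_nonneg (norm_nonneg _) hp.le, ofReal_norm]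

lemma eLpNorm_two_eq_ofReal {α F : Type*} [MeasurableSpace α] [NormedAddCommGroup F] {μ : Measure α}
    {f : α → F} {g : α → ℝ} (hg : Integrable g μ) (h : ∀ x, ‖f x‖ ^ 2 = g x) :
    eLpNorm f 2 μ = ENNReal.ofReal ((∫ x, g x ∂μ) ^ (1 / 2 : ℝ)) := by
  rw [← eLpNorm_ofReal_eq two_pos hg fun x => by rw [Real.rpow_two, h x], ENNReal.ofReal_ofNat]

lemma Q_subset_closedBall (d : ℕ) : Q d ⊆ Metric.closedBall 0 √d := fun _ hx =>
  mem_closedBall_zero_iff.2 (norm_le_of_mem_Q hx)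

lemma Continuous.integrableOn_Q {d : ℕ} {f : E d → ℝ} (hf : Continuous f) : IntegrableOn f (Q d) :=
  (hf.continuousOn.integrableOn_compact (isCompact_closedBall 0 √d)).mono_set
    (Q_subset_closedBall d)

/-- Lemma 3.3: weighted Sobolev inequality under mass and pressure bounds. -/
theorem weighted_sobolev (d : ℕ) (hd : 3 ≤ d) (γ m M : ℝ)
    (hγ : (d : ℝ) / 2 < γ) (hm : 0 < m) (hM : 0 < M) :
    ∃ C > 0, ∀ (ρ v : E d → ℝ),
      Measurable ρ → (∀ x, 0 ≤ ρ x) → Per ρ →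
      IntegrableOn ρ (Q d) → IntegrableOn (fun x => ρ x ^ γ) (Q d) →
      m ≤ (∫ x in Q d, ρ x) → (∫ x in Q d, ρ x ^ γ) ≤ M →
      ContDiff ℝ 1 v → Per v →
      (∫ x in Q d, |v x| ^ (2 * (d : ℝ) / ((d : ℝ) - 2))) ^ (((d : ℝ) - 2) / (2 * (d : ℝ)))
        ≤ C * ((∫ x in Q d, ρ x * (v x) ^ 2) ^ (1 / 2 : ℝ)
              + (∫ x in Q d, ‖gradient v x‖ ^ 2) ^ (1 / 2 : ℝ)) := by
  have hd3 : (3 : ℝ) ≤ d := by exact_mod_cast hd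
  have hd2 : 0 < (d : ℝ) - 2 := by linarith
  have hγ1 : 0 < γ - 1 := by linarith
  have hγ0 : 0 < γ := by linarith
  set r : ℝ := 2 * (d : ℝ) / ((d : ℝ) - 2) with hr
  have hr0 : 0 < r := by positivity
  have hrinv : ((d : ℝ) - 2) / (2 * (d : ℝ)) = 1 / r := by rw [hr, one_div_div]
  rw [hrinv]
  obtain ⟨A, hA⟩ := exists_const_eLpNorm_sub_le (d := d) (by omega) (p := r.toNNReal) (by
    rw [Real.coe_toNNReal _ hr0.le, hr]
    field_simp)
  set B : ℝ := M ^ (1 / (2 * γ))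
  have hB0 : 0 < B := by positivity
  let q : ℝ := 2 * γ / (γ - 1)
  have hq0 : 0 < q := by positivity
  have hqr : ENNReal.ofReal q ≤ ENNReal.ofReal r := by
    refine ENNReal.ofReal_le_ofReal ?_
    rw [div_le_div_iff₀ hγ1 hd2]
    nlinarith
  have hH : ENNReal.HolderTriple (ENNReal.ofReal (2 * γ)) (ENNReal.ofReal q) 2 := by
    constructor
    rw [← ENNReal.ofReal_inv_of_pos (by positivity), ← ENNReal.ofReal_inv_of_pos hq0,
      ← ENNReal.ofReal_add (by positivity) (by positivity), ← ENNReal.ofReal_ofNat 2,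
      ← ENNReal.ofReal_inv_of_pos (by norm_num)]
    congr 1
    simp only [q]
    field_simp
    ring
  refine ⟨A + (1 + B * A) / √m, by positivity, fun ρ v hρ hρ0 _ hρ1 hργ hmρ hMρ hv hper => ?_⟩
  have hvd : Continuous (fderiv ℝ v) := hv.continuous_fderiv (by norm_num)
  have hvc := hv.continuous
  have hgrad : ∀ x, ‖gradient v x‖ = ‖fderiv ℝ v x‖ := fun x => by simp [gradient]
  simp only [hgrad]
  obtain ⟨c, hc⟩ := hA v hv hper
  set G := (∫ x in Q d, ‖fderiv ℝ v x‖ ^ 2) ^ (1 / 2 : ℝ)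
  set R := (∫ x in Q d, ρ x * (v x) ^ 2) ^ (1 / 2 : ℝ)
  have hG0 : 0 ≤ G := Real.rpow_nonneg (integral_nonneg fun x => by positivity) _
  have hR0 : 0 ≤ R :=
    Real.rpow_nonneg (integral_nonneg fun x => mul_nonneg (hρ0 x) (sq_nonneg _)) _
  have eG : eLpNorm (fderiv ℝ v) 2 (volume.restrict (Q d)) = ENNReal.ofReal G :=
    eLpNorm_two_eq_ofReal (hvd.norm.pow 2).integrableOn_Q fun x => rfl
  have eR : eLpNorm (fun x => √(ρ x) * v x) 2 (volume.restrict (Q d)) = ENNReal.ofReal R := by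
    refine eLpNorm_two_eq_ofReal ?_ fun x => ?_
    · exact hρ1.mul_continuousOn_of_subset (hvc.pow 2).continuousOn (measurableSet_Q d)
        (isCompact_closedBall 0 √d) (Q_subset_closedBall d)
    · rw [Real.norm_eq_abs, sq_abs, mul_pow, Real.sq_sqrt (hρ0 x)]
  have eN : eLpNorm v (ENNReal.ofReal r) (volume.restrict (Q d))
      = ENNReal.ofReal ((∫ x in Q d, |v x| ^ r) ^ (1 / r)) :=
    eLpNorm_ofReal_eq hr0 (hvc.abs.rpow_const fun _ => Or.inr hr0.le).integrableOn_Q fun x => rfl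
  have em : ENNReal.ofReal √m ≤ eLpNorm (fun x => √(ρ x)) 2 (volume.restrict (Q d)) := by
    rw [eLpNorm_two_eq_ofReal (g := ρ) hρ1 fun x => by
      rw [Real.norm_eq_abs, sq_abs, Real.sq_sqrt (hρ0 x)], ← Real.sqrt_eq_rpow]
    exact ENNReal.ofReal_le_ofReal (Real.sqrt_le_sqrt hmρ)
  have eB : eLpNorm (fun x => √(ρ x)) (ENNReal.ofReal (2 * γ)) (volume.restrict (Q d))
      ≤ ENNReal.ofReal B := by
    rw [eLpNorm_ofReal_eq (by positivity) hργ fun x => by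
      rw [Real.norm_of_nonneg (Real.sqrt_nonneg _), Real.rpow_mul (Real.sqrt_nonneg _),
        Real.rpow_two, Real.sq_sqrt (hρ0 x)]]
    exact ENNReal.ofReal_le_ofReal (Real.rpow_le_rpow
      (integral_nonneg fun x => Real.rpow_nonneg (hρ0 x) _) hMρ (by positivity))
  have hW : eLpNorm (fun x => v x - c) (ENNReal.ofReal r) (volume.restrict (Q d))
      ≤ ENNReal.ofReal (A * G) := by
    rw [ENNReal.ofReal_mul A.coe_nonneg, ← eG, ENNReal.ofReal_coe_nnreal]
    exact hc
  have h1 : (∫ x in Q d, |v x| ^ r) ^ (1 / r) ≤ A * G + |c| := by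
    rw [← ENNReal.ofReal_le_ofReal_iff (by positivity), ← eN, ENNReal.ofReal_add (by positivity)
      (abs_nonneg c)]
    have hr1 : 1 ≤ ENNReal.ofReal r := by
      rw [ENNReal.one_le_ofReal, hr, one_le_div hd2]
      linarith
    calc eLpNorm v (ENNReal.ofReal r) (volume.restrict (Q d))
        = eLpNorm ((fun x => v x - c) + fun _ => c) (ENNReal.ofReal r) (volume.restrict (Q d)) := by
          congr 1
          ext x
          simp
      _ ≤ eLpNorm (fun x => v x - c) (ENNReal.ofReal r) (volume.restrict (Q d))
          + eLpNorm (fun _ => c) (ENNReal.ofReal r) (volume.restrict (Q d)) :=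
          eLpNorm_add_le (hvc.sub continuous_const).aestronglyMeasurable
            aestronglyMeasurable_const hr1
      _ ≤ _ := by
          gcongr
          rw [eLpNorm_const _ (by simpa using hr0) (IsProbabilityMeasure.ne_zero _), measure_univ,
            ENNReal.one_rpow, mul_one, ← ofReal_norm, Real.norm_eq_abs]
  have h2 : |c| * √m ≤ R + B * (A * G) := by
    rw [← ENNReal.ofReal_le_ofReal_iff (by positivity), ENNReal.ofReal_mul (abs_nonneg c),
      ENNReal.ofReal_add hR0 (by positivity), ENNReal.ofReal_mul hB0.le, ← eR,
      ← Real.norm_eq_abs, ofReal_norm]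
    calc ‖c‖ₑ * ENNReal.ofReal √m
        ≤ ‖c‖ₑ * eLpNorm (fun x => √(ρ x)) 2 (volume.restrict (Q d)) := by gcongr
      _ ≤ _ := enorm_mul_eLpNorm_sqrt_le hρ hvc.aestronglyMeasurable
          (p := ENNReal.ofReal (2 * γ)) hqr c
      _ ≤ _ := by gcongr
  have hsm : 0 < √m := Real.sqrt_pos.2 hm
  rw [← le_div_iff₀ hsm] at h2
  calc (∫ x in Q d, |v x| ^ r) ^ (1 / r) ≤ A * G + (R + B * (A * G)) / √m := by linarith
    _ ≤ A * (R + G) + ((1 + B * A) * (R + G)) / √m := by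
        have hA0 : (0 : ℝ) ≤ A := A.2
        have hBA : 0 ≤ B * A * R := by positivity
        gcongr
        · linarith
        · linarith
    _ = _ := by ring

end
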